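/- Let d ≥ 1, n = d+1, and fix nonnegative integers ℓ₁, ℓ₂ with ℓ := ℓ₁+ℓ₂ < d and ℓ₁ ≤ ℓ₂. For any symmetrical code that satisfies node regeneration, message recovery (for parameter ℓ), and repair secrecy (for parameters ℓ₁, ℓ₂), and for any reals α, β with H(W_i) ≤ α for all i ∈ [1:n] and H(S_{i→j}) ≤ β for all i ≠ j in [1:n], one has α + T_{d,d,ℓ₁+1} β ≥ (T_{d,d,ℓ₁} + ℓ₁) Σ_{j=ℓ+1}^{d} T_{d,j,ℓ}^{−1} B_j. (Unnormalized form of outer bound (10) of Theorem 1.) -/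

import Mathlib

open scoped BigOperators Classical

namespace MDCSR

noncomputable section

/-- `X` is a deterministic function of `Y`. -/
def IsFuncOf {Ω α β : Type*} (X : Ω → α) (Y : Ω → β) : Prop :=
  ∃ f : β → α, ∀ ω, X ω = f (Y ω)

variable {Ω V : Type} [Fintype Ω]

/-- Probability of the event `X = x` under the probability mass function `p`. -/
def pm (p : Ω → ℝ) {α : Type*} (X : Ω → α) (x : α) : ℝ :=
  ∑ ω ∈ Finset.univ.filter (fun ω' => X ω' = x), p ω

/-- Shannon entropy of the random variable `X` under the probability mass function `p`. -/
def H (p : Ω → ℝ) {α : Type*} (X : Ω → α) : ℝ :=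
  -∑ ω, p ω * Real.log (pm p X (X ω))

/-- An `(n = d+1, d)` code: messages `M 1, …, M d`, a key `K`, node contents
`W 1, …, W (d+1)`, and repair data `S i j` (data downloaded from node `i` to repair
node `j`), all random variables on a common finite probability space `(Ω, p)`.
The messages are mutually independent, the key is independent of the messages,
each `W i` is a deterministic function of the messages and the key, and each
`S i j` is a deterministic function of `W i`. -/
structure Code (Ω V : Type) [Fintype Ω] (d : ℕ) : Type where
  p : Ω → ℝ
  p_nonneg : ∀ ω, 0 ≤ p ω
  p_sum : ∑ ω, p ω = 1
  M : ℕ → Ω → V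
  K : Ω → V
  W : ℕ → Ω → V
  S : ℕ → ℕ → Ω → V
  M_indep : ∀ x : ℕ → V,
    pm p (fun ω (i : Fin d) => M (↑i + 1) ω) (fun i => x (↑i + 1)) =
      ∏ i ∈ Finset.Icc 1 d, pm p (M i) (x i)
  K_indep : ∀ (k : V) (x : ℕ → V),
    pm p (fun ω => (K ω, fun (i : Fin d) => M (↑i + 1) ω)) (k, fun i => x (↑i + 1)) =
      pm p K k * pm p (fun ω (i : Fin d) => M (↑i + 1) ω) (fun i => x (↑i + 1))
  W_func : ∀ i ∈ Finset.Icc 1 (d + 1),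
    IsFuncOf (W i) (fun ω => ((fun (j : Fin d) => M (↑j + 1) ω), K ω))
  S_func : ∀ i ∈ Finset.Icc 1 (d + 1), ∀ j ∈ Finset.Icc 1 (d + 1), i ≠ j →
    IsFuncOf (S i j) (W i)

/-- Descriptors for the basic random variables of a code. -/
inductive Atom where
  | M : ℕ → Atom
  | K : Atom
  | W : ℕ → Atom
  | S : ℕ → ℕ → Atom

variable {d : ℕ}

/-- The random variable described by an atom. -/
def Code.atomRV (C : Code Ω V d) : Atom → Ω → V
  | .M i => C.M i
  | .K => C.K
  | .W i => C.W i
  | .S i j => C.S i j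

/-- The joint random variable (tuple) described by a list of atoms. -/
def Code.rv (C : Code Ω V d) (L : List Atom) : Ω → List V :=
  fun ω => L.map fun a => C.atomRV a ω

/-- Joint entropy of a tuple of basic random variables. -/
def Code.HL (C : Code Ω V d) (L : List Atom) : ℝ := H C.p (C.rv L)

/-- Conditional entropy `H(L₁ | L₂)`. -/
def Code.CH (C : Code Ω V d) (L₁ L₂ : List Atom) : ℝ := C.HL (L₁ ++ L₂) - C.HL L₂

/-- Mutual information `I(L₁ ; L₂)`. -/
def Code.MI (C : Code Ω V d) (L₁ L₂ : List Atom) : ℝ :=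
  C.HL L₁ + C.HL L₂ - C.HL (L₁ ++ L₂)

/-- Relabeling of an atom along a permutation of the storage-node indices. -/
def Atom.perm (π : Equiv.Perm ℕ) : Atom → Atom
  | .M i => .M i
  | .K => .K
  | .W i => .W (π i)
  | .S i j => .S (π i) (π j)

/-- A code is symmetrical if every joint entropy of a tuple of the basic random
variables is invariant under every permutation of the storage-node indices `[1:n]`. -/
def Code.Symmetrical (C : Code Ω V d) : Prop :=
  ∀ π : Equiv.Perm ℕ, (∀ i ∈ Finset.Icc 1 (d + 1), π i ∈ Finset.Icc 1 (d + 1)) →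
    ∀ L : List Atom, C.HL (L.map (Atom.perm π)) = C.HL L

/-- The list `[a, a+1, …, b]`. -/
def icc (a b : ℕ) : List ℕ := List.range' a (b + 1 - a)

/-- `W_A` as a list of atoms. -/
def Ws (A : List ℕ) : List Atom := A.map Atom.W

/-- `M_A` as a list of atoms. -/
def MsL (A : List ℕ) : List Atom := A.map Atom.M

/-- `M^{(m)} = (M_1, …, M_m)`. -/
def Mup (m : ℕ) : List Atom := MsL (icc 1 m)

/-- `S_{B → j}`. -/
def Sto (B : List ℕ) (j : ℕ) : List Atom := B.map fun i => Atom.S i j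

/-- `S_{i → B}`. -/
def Sfrom (i : ℕ) (B : List ℕ) : List Atom := B.map fun j => Atom.S i j

/-- `S̄_{→ j} = S_{[j+1:n] → j}` (here `n = d+1`). -/
def SbarTo (d j : ℕ) : List Atom := Sto (icc (j + 1) (d + 1)) j

/-- `S̄_{→ A}`. -/
def SbarToL (d : ℕ) (A : List ℕ) : List Atom := (A.map (SbarTo d)).flatten

/-- `S̲_{→ j} = S_{[1:j-1] → j}`. -/
def SunderTo (j : ℕ) : List Atom := Sto (icc 1 (j - 1)) j

/-- `S̲_{→ A}`. -/
def SunderToL (A : List ℕ) : List Atom := (A.map SunderTo).flatten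

/-- `S_{→ j} = S_{([1:n] ∖ {j}) → j}` (here `n = d+1`). -/
def StoFull (d j : ℕ) : List Atom := Sto ((icc 1 (d + 1)).filter (fun i => i ≠ j)) j

/-- `(S_{→ j} : j ∈ A)`. -/
def StoFullL (d : ℕ) (A : List ℕ) : List Atom := (A.map (StoFull d)).flatten

/-- `U^{(t,s)} = (W_{[1:t]}, S̄_{→[t+1:s]})`. -/
def U (d t s : ℕ) : List Atom := Ws (icc 1 t) ++ SbarToL d (icc (t + 1) s)

/-- Node regeneration: each `W j` is a deterministic function of `S_{→ j}`. -/
def Code.NodeRegen (C : Code Ω V d) : Prop :=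
  ∀ j ∈ Finset.Icc 1 (d + 1), IsFuncOf (C.W j) (C.rv (StoFull d j))

/-- Message recovery for parameter `ℓ`: `M j` is constant for `j ∈ [1:ℓ]`, and for every
`A ⊆ [1:n]` with `|A| ∈ [ℓ+1:d]`, `M_{|A|}` is a deterministic function of `W_A`. -/
def Code.MsgRecovery (C : Code Ω V d) (ℓ : ℕ) : Prop :=
  (∀ j ∈ Finset.Icc 1 ℓ, ∃ c : V, ∀ ω, C.M j ω = c) ∧
  ∀ A : Finset ℕ, A ⊆ Finset.Icc 1 (d + 1) → A.card ∈ Finset.Icc (ℓ + 1) d →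
    IsFuncOf (C.M A.card) (C.rv (Ws (A.sort (· ≤ ·))))

/-- Repair secrecy for parameters `ℓ₁, ℓ₂`: for all disjoint `E₁, E₂ ⊆ [1:n]` with
`|E₁| = ℓ₁`, `|E₂| = ℓ₂`, the messages `M_{ℓ+1}, …, M_d` are independent of
`((W_i : i ∈ E₁), (S_{→j} : j ∈ E₂))`, where `ℓ = ℓ₁ + ℓ₂`. -/
def Code.RepairSecrecy (C : Code Ω V d) (ℓ₁ ℓ₂ : ℕ) : Prop :=
  ∀ E₁ E₂ : Finset ℕ, E₁ ⊆ Finset.Icc 1 (d + 1) → E₂ ⊆ Finset.Icc 1 (d + 1) →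
    Disjoint E₁ E₂ → E₁.card = ℓ₁ → E₂.card = ℓ₂ →
    C.MI (MsL (icc (ℓ₁ + ℓ₂ + 1) d))
      (Ws (E₁.sort (· ≤ ·)) ++ StoFullL d (E₂.sort (· ≤ ·))) = 0

/-- `T_{d,k,ℓ} = Σ_{t=ℓ+1}^{k} (d+1−t)`, as a real number. -/
def T (d k ℓ : ℕ) : ℝ := ∑ t ∈ Finset.Icc (ℓ + 1) k, ((d : ℝ) + 1 - (t : ℝ))

section Entropy

/-- Mass of the class of `ω` under the equivalence relation `r`. -/
def classMass (p : Ω → ℝ) (r : Setoid Ω) (ω : Ω) : ℝ :=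
  ∑ x ∈ Finset.univ.filter (fun x => r x ω), p x

/-- Entropy of the partition of `Ω` into the classes of `r`. -/
def ent (p : Ω → ℝ) (r : Setoid Ω) : ℝ :=
  -∑ ω, p ω * Real.log (classMass p r ω)

variable {p : Ω → ℝ}

theorem classMass_nonneg (hp : ∀ ω, 0 ≤ p ω) (r : Setoid Ω) (ω : Ω) : 0 ≤ classMass p r ω :=
  Finset.sum_nonneg fun _ _ => hp _

theorem le_classMass (hp : ∀ ω, 0 ≤ p ω) (r : Setoid Ω) (ω : Ω) : p ω ≤ classMass p r ω :=
  Finset.single_le_sum (f := p) (fun _ _ => hp _)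
    (Finset.mem_filter.2 ⟨Finset.mem_univ _, r.refl ω⟩)

theorem classMass_congr (r : Setoid Ω) {ω ω' : Ω} (h : r ω ω') :
    classMass p r ω = classMass p r ω' := by
  unfold classMass
  congr 1
  ext x
  simp only [Finset.mem_filter, Finset.mem_univ, true_and]
  exact ⟨fun hx => r.trans hx h, fun hx => r.trans hx (r.symm h)⟩

theorem ent_mono (hp : ∀ ω, 0 ≤ p ω) {r s : Setoid Ω} (h : r ≤ s) : ent p s ≤ ent p r := by
  refine neg_le_neg (Finset.sum_le_sum fun ω _ => ?_)
  rcases (hp ω).eq_or_lt with h0 | h0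
  · simp [← h0]
  · refine mul_le_mul_of_nonneg_left (Real.log_le_log (h0.trans_le (le_classMass hp r ω)) ?_) h0.le
    refine Finset.sum_le_sum_of_subset_of_nonneg (fun x hx => ?_) fun _ _ _ => hp _
    simp only [Finset.mem_filter, Finset.mem_univ, true_and] at hx ⊢
    exact h hx

theorem sum_div_classMass_le (hp : ∀ ω, 0 ≤ p ω) (r : Setoid Ω) (X : Finset Ω)
    (hX : ∀ a ∈ X, ∀ b ∈ X, r a b) : ∑ ω ∈ X, p ω / classMass p r ω ≤ 1 := by
  rcases X.eq_empty_or_nonempty with rfl | ⟨a, ha⟩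
  · simp
  · have h1 : ∑ ω ∈ X, p ω / classMass p r ω = (∑ ω ∈ X, p ω) / classMass p r a := by
      rw [Finset.sum_div]
      exact Finset.sum_congr rfl fun ω hω => by rw [classMass_congr r (hX ω hω a ha)]
    rw [h1]
    refine div_le_one_of_le₀ ?_ (classMass_nonneg hp r a)
    refine Finset.sum_le_sum_of_subset_of_nonneg (fun x hx => ?_) fun _ _ _ => hp _
    simpa using hX x hx a ha

theorem sum_mass_ratio_le (hp : ∀ ω, 0 ≤ p ω) (hp1 : ∑ ω, p ω = 1) (r : Setoid Ω)
    {s t : Setoid Ω} (h : s ≤ t) :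
    ∑ ω, p ω * (classMass p (r ⊓ t) ω * classMass p s ω /
      (classMass p (r ⊓ s) ω * classMass p t ω)) ≤ 1 := by
  have expand : ∀ ω, p ω * (classMass p (r ⊓ t) ω * classMass p s ω /
      (classMass p (r ⊓ s) ω * classMass p t ω)) =
      ∑ a, ∑ b, if (r ⊓ t) a ω ∧ s b ω then
        p a * p b * (p ω / classMass p (r ⊓ s) ω / classMass p t ω) else 0 := by
    intro ω
    have h1 : classMass p (r ⊓ t) ω * classMass p s ω =
        ∑ a, ∑ b, if (r ⊓ t) a ω ∧ s b ω then p a * p b else 0 := by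
      unfold classMass
      rw [Finset.sum_filter, Finset.sum_filter, Finset.sum_mul_sum]
      refine Finset.sum_congr rfl fun a _ => Finset.sum_congr rfl fun b _ => ?_
      by_cases ha : (r ⊓ t) a ω <;> by_cases hb : s b ω <;> simp [ha, hb]
    rw [h1, ← mul_div_assoc, mul_comm, mul_div_assoc, Finset.sum_mul]
    refine Finset.sum_congr rfl fun a _ => ?_
    rw [Finset.sum_mul]
    refine Finset.sum_congr rfl fun b _ => ?_
    split_ifs
    · rw [div_div]
    · simp
  have inner : ∀ a b, (∑ ω, if (r ⊓ t) a ω ∧ s b ω then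
        p a * p b * (p ω / classMass p (r ⊓ s) ω / classMass p t ω) else 0) ≤
      if t b a then p a * p b / classMass p t a else 0 := by
    intro a b
    rw [← Finset.sum_filter]
    split_ifs with hab
    · have h1 : ∀ ω ∈ Finset.univ.filter (fun ω => (r ⊓ t) a ω ∧ s b ω),
          p a * p b * (p ω / classMass p (r ⊓ s) ω / classMass p t ω) =
          p a * p b / classMass p t a * (p ω / classMass p (r ⊓ s) ω) := by
        intro ω hω
        rw [Finset.mem_filter] at hω
        rw [classMass_congr t hω.2.1.2]
        ring
      rw [Finset.sum_congr rfl h1, ← Finset.mul_sum]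
      refine mul_le_of_le_one_right (div_nonneg (mul_nonneg (hp _) (hp _))
        (classMass_nonneg hp _ _)) (sum_div_classMass_le hp _ _ fun x hx y hy => ?_)
      rw [Finset.mem_filter] at hx hy
      exact ⟨r.trans (r.symm hx.2.1.1) hy.2.1.1, s.trans (s.symm hx.2.2) hy.2.2⟩
    · refine le_of_eq (Finset.sum_eq_zero fun ω hω => ?_)
      rw [Finset.mem_filter] at hω
      exact absurd (t.trans (h hω.2.2) (t.symm hω.2.1.2)) hab
  calc _ = ∑ ω, ∑ a, ∑ b, (if (r ⊓ t) a ω ∧ s b ω then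
        p a * p b * (p ω / classMass p (r ⊓ s) ω / classMass p t ω) else 0) :=
        Finset.sum_congr rfl fun ω _ => expand ω
    _ = ∑ a, ∑ b, ∑ ω, (if (r ⊓ t) a ω ∧ s b ω then
        p a * p b * (p ω / classMass p (r ⊓ s) ω / classMass p t ω) else 0) := by
        rw [Finset.sum_comm]
        exact Finset.sum_congr rfl fun a _ => Finset.sum_comm
    _ ≤ ∑ a, ∑ b, (if t b a then p a * p b / classMass p t a else 0) :=
        Finset.sum_le_sum fun a _ => Finset.sum_le_sum fun b _ => inner a b
    _ ≤ ∑ a, p a := by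
        refine Finset.sum_le_sum fun a _ => ?_
        have h1 : ∑ b, (if t b a then p a * p b / classMass p t a else 0) =
            p a * (classMass p t a / classMass p t a) := by
          rw [← Finset.sum_filter, ← Finset.sum_div, ← Finset.mul_sum, mul_div_assoc]
          rfl
        rw [h1]
        exact mul_le_of_le_one_right (hp a) (div_self_le_one _)
    _ = 1 := hp1

/-- Conditioning on a finer partition reduces the conditional entropy. -/
theorem ent_submodular (hp : ∀ ω, 0 ≤ p ω) (hp1 : ∑ ω, p ω = 1) (r : Setoid Ω)
    {s t : Setoid Ω} (h : s ≤ t) :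
    ent p (r ⊓ s) + ent p t ≤ ent p (r ⊓ t) + ent p s := by
  have key : ∑ ω, p ω * (1 - classMass p (r ⊓ t) ω * classMass p s ω /
      (classMass p (r ⊓ s) ω * classMass p t ω)) ≤
      ∑ ω, p ω * (Real.log (classMass p (r ⊓ s) ω) + Real.log (classMass p t ω) -
        Real.log (classMass p (r ⊓ t) ω) - Real.log (classMass p s ω)) := by
    refine Finset.sum_le_sum fun ω _ => ?_
    rcases (hp ω).eq_or_lt with h0 | h0
    · simp [← h0]
    · refine mul_le_mul_of_nonneg_left ?_ h0.le
      have pos : ∀ q : Setoid Ω, 0 < classMass p q ω := fun q =>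
        h0.trans_le (le_classMass hp q ω)
      have h1 := pos (r ⊓ s)
      have h2 := pos t
      have h3 := pos (r ⊓ t)
      have h4 := pos s
      have h5 := Real.log_le_sub_one_of_pos (div_pos (mul_pos h3 h4) (mul_pos h1 h2))
      rw [Real.log_div (mul_pos h3 h4).ne' (mul_pos h1 h2).ne', Real.log_mul h3.ne' h4.ne',
        Real.log_mul h1.ne' h2.ne'] at h5
      linarith
  have h1 := sum_mass_ratio_le hp hp1 r h
  simp only [mul_sub, mul_add, Finset.sum_sub_distrib, Finset.sum_add_distrib, mul_one, hp1]
    at key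
  unfold ent
  linarith

end Entropy

namespace Code

variable (C : Code Ω V d)

/-- Two outcomes are equivalent when all variables in `s` agree on them. -/
def ker (s : Finset Atom) : Setoid Ω where
  r ω ω' := ∀ a ∈ s, C.atomRV a ω = C.atomRV a ω'
  iseqv := ⟨fun _ _ _ => rfl, fun h a ha => (h a ha).symm,
    fun h h' a ha => (h a ha).trans (h' a ha)⟩

/-- Joint entropy of a finite set of basic random variables. -/
def hs (s : Finset Atom) : ℝ := ent C.p (C.ker s)

theorem HL_eq_hs (L : List Atom) : C.HL L = C.hs L.toFinset := by
  unfold HL hs H ent pm classMass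
  refine congrArg Neg.neg (Finset.sum_congr rfl fun ω _ => ?_)
  congr 3
  ext ω'
  simp only [Finset.mem_filter, Finset.mem_univ, true_and, rv, List.map_inj_left]
  exact ⟨fun h a ha => h a (List.mem_toFinset.1 ha), fun h a ha => h a (List.mem_toFinset.2 ha)⟩

theorem ker_union (s t : Finset Atom) : C.ker (s ∪ t) = C.ker s ⊓ C.ker t := by
  ext ω ω'
  constructor
  · exact fun h => ⟨fun a ha => h a (Finset.mem_union_left _ ha),
      fun a ha => h a (Finset.mem_union_right _ ha)⟩
  · rintro ⟨h1, h2⟩ a ha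
    exact (Finset.mem_union.1 ha).elim (h1 a) (h2 a)

variable {C} in
theorem ker_le_of_subset {s t : Finset Atom} (h : s ⊆ t) : C.ker t ≤ C.ker s :=
  fun _ _ hω a ha => hω a (h ha)

variable {C} in
theorem hs_mono {s t : Finset Atom} (h : C.ker t ≤ C.ker s) : C.hs s ≤ C.hs t :=
  ent_mono C.p_nonneg h

variable {C} in
theorem hs_congr {s t : Finset Atom} (h : C.ker t ≤ C.ker s) (h' : C.ker s ≤ C.ker t) :
    C.hs s = C.hs t :=
  (hs_mono h).antisymm (hs_mono h')

variable {C} in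
/-- Conditioning on variables that determine more reduces the conditional entropy. -/
theorem hs_union_sub_le {s t : Finset Atom} (x : Finset Atom) (h : C.ker s ≤ C.ker t) :
    C.hs (x ∪ s) - C.hs s ≤ C.hs (x ∪ t) - C.hs t := by
  have := ent_submodular C.p_nonneg C.p_sum (C.ker x) h
  unfold hs
  rw [ker_union, ker_union]
  linarith

theorem hs_empty : C.hs ∅ = 0 := by
  have : ∀ ω, classMass C.p (C.ker ∅) ω = 1 := by
    intro ω
    rw [← C.p_sum]
    unfold classMass
    congr 1
    ext ω'
    simp only [Finset.mem_filter, Finset.mem_univ, true_and, iff_true]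
    exact fun a ha => absurd ha (Finset.notMem_empty a)
  simp [hs, ent, this]

theorem hs_union_le (s t : Finset Atom) : C.hs (s ∪ t) ≤ C.hs s + C.hs t := by
  have := hs_union_sub_le (C := C) s (ker_le_of_subset (Finset.empty_subset t))
  rw [hs_empty, Finset.union_empty] at this
  linarith

theorem HL_singleton (a : Atom) : C.HL [a] = C.hs {a} := by
  rw [HL_eq_hs]
  congr 1

variable {C} in
theorem Symmetrical.hs_image (hC : C.Symmetrical) {π : Equiv.Perm ℕ}
    (hπ : ∀ i ∈ Finset.Icc 1 (d + 1), π i ∈ Finset.Icc 1 (d + 1)) (s : Finset Atom) :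
    C.hs (s.image (Atom.perm π)) = C.hs s := by
  have := hC π hπ s.toList
  rw [HL_eq_hs, HL_eq_hs] at this
  convert this using 2
  · ext a
    simp
  · simp

/-- The messages `M_{a+1}, …, M_b`. -/
def msgs (a b : ℕ) : Finset Atom := (Finset.Ioc a b).image Atom.M

theorem hs_union_msgs_le (s : Finset Atom) {a b c : ℕ} (hab : a ≤ b) (hbc : b ≤ c) :
    C.hs (s ∪ msgs a c) ≤ C.hs (s ∪ msgs a b) + ∑ j ∈ Finset.Ioc b c, C.hs {Atom.M j} := by
  induction c, hbc using Nat.le_induction with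
  | base => simp
  | succ c hbc ih =>
    have h1 : s ∪ msgs a (c + 1) = (s ∪ msgs a c) ∪ {Atom.M (c + 1)} := by
      unfold msgs
      rw [← Finset.insert_Ioc_right_eq_Ioc_add_one (by omega), Finset.image_insert,
        Finset.insert_eq, Finset.union_comm {_}, Finset.union_assoc]
    rw [h1, ← Finset.insert_Ioc_right_eq_Ioc_add_one (by omega), Finset.sum_insert (by simp)]
    linarith [C.hs_union_le (s ∪ msgs a c) {Atom.M (c + 1)}]

theorem hs_msgs : C.hs (msgs 0 d) = ∑ j ∈ Finset.Ioc 0 d, C.hs {Atom.M j} := by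
  have mass : ∀ ω, classMass C.p (C.ker (msgs 0 d)) ω =
      ∏ j ∈ Finset.Ioc 0 d, classMass C.p (C.ker {Atom.M j}) ω := by
    intro ω
    have h := C.M_indep fun i => C.M i ω
    have h1 : pm C.p (fun ω (i : Fin d) => C.M (↑i + 1) ω) (fun i => C.M (↑i + 1) ω) =
        classMass C.p (C.ker (msgs 0 d)) ω := by
      unfold pm classMass
      congr 1
      ext ω'
      simp only [Finset.mem_filter, Finset.mem_univ, true_and, funext_iff]
      constructor
      · intro h a ha
        obtain ⟨j, hj, rfl⟩ := Finset.mem_image.1 ha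
        rw [Finset.mem_Ioc] at hj
        have := h ⟨j - 1, by omega⟩
        rwa [show j - 1 + 1 = j by omega] at this
      · intro h i
        exact h (Atom.M (i + 1)) (Finset.mem_image_of_mem _ (Finset.mem_Ioc.2 ⟨by omega, by omega⟩))
    rw [← h1, h, show Finset.Icc 1 d = Finset.Ioc 0 d from rfl]
    refine Finset.prod_congr rfl fun j _ => ?_
    unfold pm classMass
    congr 1
    ext ω'
    simp only [Finset.mem_filter, Finset.mem_univ, true_and]
    exact ⟨fun h a ha => by rw [Finset.mem_singleton.1 ha]; exact h,
      fun h => h _ (Finset.mem_singleton_self _)⟩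
  unfold hs ent
  rw [Finset.sum_neg_distrib, Finset.sum_comm]
  congr 1
  refine Finset.sum_congr rfl fun ω _ => ?_
  rw [← Finset.mul_sum]
  rcases (C.p_nonneg ω).eq_or_lt with h0 | h0
  · simp [← h0]
  · rw [mass, Real.log_prod fun j _ => ne_of_gt (h0.trans_le (le_classMass C.p_nonneg _ ω))]

/-- The storage nodes `1, …, d + 1`. -/
abbrev nodes (d : ℕ) : Finset ℕ := Finset.Icc 1 (d + 1)

/-- The repair data `S_{I → j}`. -/
def edges (I : Finset ℕ) (j : ℕ) : Finset Atom := I.image fun i => Atom.S i j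

/-- The variables `W_A`, `S_{→ B}` and `M_{ℓ+1}, …, M_m`. -/
def cfg (d ℓ : ℕ) (A B : Finset ℕ) (m : ℕ) : Finset Atom :=
  A.image Atom.W ∪ B.biUnion (fun j => edges ((nodes d).erase j) j) ∪ msgs ℓ m

theorem exists_perm_of_card_eq {N A B A' B' : Finset ℕ} (hA : A ⊆ N) (hB : B ⊆ N)
    (hA' : A' ⊆ N) (hB' : B' ⊆ N) (hAB : Disjoint A B) (hAB' : Disjoint A' B')
    (hcA : A.card = A'.card) (hcB : B.card = B'.card) :
    ∃ π : Equiv.Perm ℕ, N.image π = N ∧ A.image π = A' ∧ B.image π = B' := by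
  let col (A B : Finset ℕ) (x : ℕ) : Fin 4 :=
    if x ∈ A then 0 else if x ∈ B then 1 else if x ∈ N then 2 else 3
  have col0 : ∀ A B x, col A B x = 0 ↔ x ∈ A := by
    intro A B x
    simp only [col]
    split_ifs <;> simp [*]
  have col1 : ∀ A B, Disjoint A B → ∀ x, col A B x = 1 ↔ x ∈ B := by
    intro A B h x
    have : x ∈ A → x ∉ B := fun hx => Finset.disjoint_left.1 h hx
    simp only [col]
    split_ifs <;> simp_all
  have col2 : ∀ A B x, col A B x = 2 ↔ x ∈ N \ (A ∪ B) := by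
    intro A B x
    simp only [col]
    split_ifs <;> simp [*]
  have col3 : ∀ A B, A ⊆ N → B ⊆ N → ∀ x, col A B x = 3 ↔ x ∉ N := by
    intro A B h h' x
    have h1 : x ∈ A → x ∈ N := fun hx => h hx
    have h2 : x ∈ B → x ∈ N := fun hx => h' hx
    simp only [col]
    split_ifs <;> simp_all
  have card_rest : (N \ (A ∪ B)).card = (N \ (A' ∪ B')).card := by
    rw [Finset.card_sdiff_of_subset (Finset.union_subset hA hB),
      Finset.card_sdiff_of_subset (Finset.union_subset hA' hB'),
      Finset.card_union_of_disjoint hAB, Finset.card_union_of_disjoint hAB', hcA, hcB]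
  have fibre : ∀ k, Nonempty ({x // col A B x = k} ≃ {x // col A' B' x = k}) := by
    intro k
    fin_cases k
    · exact ⟨(Equiv.subtypeEquivRight (col0 A B)).trans ((Finset.equivOfCardEq hcA).trans
        (Equiv.subtypeEquivRight (col0 A' B')).symm)⟩
    · exact ⟨(Equiv.subtypeEquivRight (col1 A B hAB)).trans ((Finset.equivOfCardEq hcB).trans
        (Equiv.subtypeEquivRight (col1 A' B' hAB')).symm)⟩
    · exact ⟨(Equiv.subtypeEquivRight (col2 A B)).trans ((Finset.equivOfCardEq card_rest).trans
        (Equiv.subtypeEquivRight (col2 A' B')).symm)⟩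
    · exact ⟨(Equiv.subtypeEquivRight (col3 A B hA hB)).trans
        (Equiv.subtypeEquivRight (col3 A' B' hA' hB')).symm⟩
  let π : Equiv.Perm ℕ := (Equiv.sigmaFiberEquiv (col A B)).symm.trans
    ((Equiv.sigmaCongrRight fun k => (fibre k).some).trans (Equiv.sigmaFiberEquiv (col A' B')))
  have hπ : ∀ x, col A' B' (π x) = col A B x := fun x =>
    ((fibre (col A B x)).some ⟨x, rfl⟩).2
  have image_eq : ∀ X Y : Finset ℕ, (∀ x, π x ∈ Y ↔ x ∈ X) → X.image π = Y := by
    intro X Y h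
    ext y
    rw [Finset.mem_image]
    constructor
    · rintro ⟨x, hx, rfl⟩
      exact (h x).2 hx
    · intro hy
      exact ⟨π.symm y, (h _).1 (by simpa using hy), by simp⟩
  refine ⟨π, image_eq _ _ fun x => ?_, image_eq _ _ fun x => ?_, image_eq _ _ fun x => ?_⟩
  · rw [← not_iff_not, ← col3 A' B' hA' hB', ← col3 A B hA hB, hπ]
  · rw [← col0 A' B', ← col0 A B, hπ]
  · rw [← col1 A' B' hAB', ← col1 A B hAB, hπ]

theorem image_swap_of_notMem {X : Finset ℕ} {i i' : ℕ} (hi : i ∉ X) (hi' : i' ∉ X) :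
    X.image (Equiv.swap i i') = X := by
  conv_rhs => rw [← Finset.image_id (s := X)]
  refine Finset.image_congr fun x hx => ?_
  exact Equiv.swap_apply_of_ne_of_ne (fun h => hi (h ▸ hx)) fun h => hi' (h ▸ hx)

theorem image_swap_of_mem {X : Finset ℕ} {i i' : ℕ} (hi : i ∈ X) (hi' : i' ∈ X) :
    X.image (Equiv.swap i i') = X := by
  refine Finset.eq_of_subset_of_card_le ?_ ?_
  · intro y hy
    obtain ⟨x, hx, rfl⟩ := Finset.mem_image.1 hy
    rw [Equiv.swap_apply_def]
    split_ifs <;> assumption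
  · rw [Finset.card_image_of_injective _ (Equiv.injective _)]

theorem image_msgs (π : Equiv.Perm ℕ) (a b : ℕ) :
    (msgs a b).image (Atom.perm π) = msgs a b := by
  unfold msgs
  rw [Finset.image_image]
  rfl

theorem image_edges (π : Equiv.Perm ℕ) (I : Finset ℕ) (j : ℕ) :
    (edges I j).image (Atom.perm π) = edges (I.image π) (π j) := by
  unfold edges
  rw [Finset.image_image, Finset.image_image]
  rfl

theorem image_cfg {π : Equiv.Perm ℕ} (hπ : (nodes d).image π = nodes d) (ℓ : ℕ)
    (A B : Finset ℕ) (m : ℕ) :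
    (cfg d ℓ A B m).image (Atom.perm π) = cfg d ℓ (A.image π) (B.image π) m := by
  unfold cfg
  rw [Finset.image_union, Finset.image_union, image_msgs, Finset.image_biUnion,
    Finset.biUnion_image, Finset.image_image, Finset.image_image]
  congr 2
  refine Finset.biUnion_congr rfl fun j _ => ?_
  rw [image_edges, Finset.image_erase π.injective, hπ]

theorem edges_union (I J : Finset ℕ) (j : ℕ) : edges (I ∪ J) j = edges I j ∪ edges J j :=
  Finset.image_union _ _

theorem edges_insert (i : ℕ) (I : Finset ℕ) (j : ℕ) :
    edges (insert i I) j = {Atom.S i j} ∪ edges I j := by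
  unfold edges
  rw [Finset.image_insert, Finset.insert_eq]

variable {C}

theorem Symmetrical.hs_cfg_eq (hC : C.Symmetrical) (ℓ m : ℕ) {A B A' B' : Finset ℕ}
    (hA : A ⊆ nodes d) (hB : B ⊆ nodes d) (hA' : A' ⊆ nodes d) (hB' : B' ⊆ nodes d)
    (hAB : Disjoint A B) (hAB' : Disjoint A' B') (hcA : A.card = A'.card)
    (hcB : B.card = B'.card) :
    C.hs (cfg d ℓ A B m) = C.hs (cfg d ℓ A' B' m) := by
  obtain ⟨π, hN, rfl, rfl⟩ := exists_perm_of_card_eq hA hB hA' hB' hAB hAB' hcA hcB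
  rw [← image_cfg hN, hC.hs_image]
  intro i hi
  have := Finset.mem_image_of_mem π (show i ∈ nodes d from hi)
  rwa [hN] at this

/-- Exchanging one source node of a repair leaves the joint entropy with an invariant
family unchanged. -/
theorem Symmetrical.hs_swap (hC : C.Symmetrical) {c : Finset Atom} {i i' j : ℕ}
    {K : Finset ℕ} (hi : i ∈ nodes d) (hi' : i' ∈ nodes d) (hij : i ≠ j) (hij' : i' ≠ j)
    (hiK : i ∉ K) (hiK' : i' ∉ K) (hc : c.image (Atom.perm (Equiv.swap i i')) = c) :
    C.hs ({Atom.S i j} ∪ (edges K j ∪ c)) = C.hs ({Atom.S i' j} ∪ (edges K j ∪ c)) := by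
  rw [← hC.hs_image (π := Equiv.swap i i')]
  · rw [Finset.image_union, Finset.image_union, image_edges, image_swap_of_notMem hiK hiK', hc,
      Equiv.swap_apply_of_ne_of_ne hij.symm hij'.symm, Finset.image_singleton]
    simp only [Atom.perm, Equiv.swap_apply_left,
      Equiv.swap_apply_of_ne_of_ne hij.symm hij'.symm]
  · intro x hx
    rw [Equiv.swap_apply_def]
    split_ifs <;> assumption

theorem Symmetrical.hs_edges_union_le (hC : C.Symmetrical) {c : Finset Atom} {i₀ j : ℕ}
    {K : Finset ℕ} (hi₀ : i₀ ∈ nodes d) (hi₀j : i₀ ≠ j) (hK : K ⊆ nodes d) (hjK : j ∉ K)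
    (hc : ∀ i ∈ K, c.image (Atom.perm (Equiv.swap i i₀)) = c) :
    C.hs (edges K j ∪ c) - C.hs c ≤ K.card * (C.hs ({Atom.S i₀ j} ∪ c) - C.hs c) := by
  induction K using Finset.induction_on with
  | empty => simp [edges]
  | insert i K hi ih =>
    have hiN : i ∈ nodes d := hK (Finset.mem_insert_self i K)
    have h1 := ih ((Finset.subset_insert i K).trans hK)
      (fun h => hjK (Finset.mem_insert_of_mem h))
      fun x hx => hc x (Finset.mem_insert_of_mem hx)
    have h2 := hC.hs_swap (K := ∅) (j := j) hiN hi₀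
      (fun h => hjK (h ▸ Finset.mem_insert_self i K)) hi₀j (by simp) (by simp)
      (hc i (Finset.mem_insert_self i K))
    have h3 := hs_union_sub_le (C := C) {Atom.S i j}
      (ker_le_of_subset (Finset.subset_union_right (s₁ := edges K j) (s₂ := c)))
    simp only [edges, Finset.image_empty, Finset.empty_union] at h2
    rw [edges_insert, Finset.union_assoc, Finset.card_insert_of_notMem hi]
    push_cast
    linarith

theorem Symmetrical.le_hs_edges_union (hC : C.Symmetrical) {c c' : Finset Atom} {i₀ j : ℕ}
    {K : Finset ℕ} (hi₀ : i₀ ∈ nodes d) (hi₀j : i₀ ≠ j) (hi₀K : i₀ ∉ K) (hK : K ⊆ nodes d)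
    (hjK : j ∉ K) (hc : ∀ i ∈ K, c.image (Atom.perm (Equiv.swap i i₀)) = c)
    (hc' : C.ker c' ≤ C.ker (edges K j ∪ c)) :
    K.card * (C.hs ({Atom.S i₀ j} ∪ c') - C.hs c') ≤ C.hs (edges K j ∪ c) - C.hs c := by
  induction K using Finset.induction_on with
  | empty => simp [edges]
  | insert i K hi ih =>
    have hiN : i ∈ nodes d := hK (Finset.mem_insert_self i K)
    have hker : C.ker c' ≤ C.ker (edges K j ∪ c) := hc'.trans (ker_le_of_subset
      (Finset.union_subset_union_left (Finset.image_subset_image (Finset.subset_insert i K))))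
    have hi₀K' : i₀ ∉ K := fun h => hi₀K (Finset.mem_insert_of_mem h)
    have h1 := ih hi₀K' ((Finset.subset_insert i K).trans hK)
      (fun h => hjK (Finset.mem_insert_of_mem h))
      (fun x hx => hc x (Finset.mem_insert_of_mem hx)) hker
    have h2 := hC.hs_swap (j := j) hiN hi₀ (fun h => hjK (h ▸ Finset.mem_insert_self i K)) hi₀j
      hi hi₀K' (hc i (Finset.mem_insert_self i K))
    have h3 := hs_union_sub_le (C := C) {Atom.S i₀ j} hker
    rw [edges_insert, Finset.union_assoc, Finset.card_insert_of_notMem hi]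
    push_cast
    linarith

/-- The average conditional entropy of repair data decreases when the content of some of the
helpers is added to the conditioning. -/
theorem Symmetrical.hs_edges_exchange (hC : C.Symmetrical) {c c' : Finset Atom} {j : ℕ}
    {I J : Finset ℕ} (hI : I ⊆ nodes d) (hJ : J ⊆ nodes d) (hIJ : Disjoint I J) (hjI : j ∉ I)
    (hjJ : j ∉ J)
    (hc : ∀ i ∈ I ∪ J, ∀ i' ∈ I, c.image (Atom.perm (Equiv.swap i i')) = c)
    (hc' : C.ker c' ≤ C.ker (edges J j ∪ c)) :
    ((I.card : ℝ) + J.card) * (C.hs (edges I j ∪ c') - C.hs c') ≤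
      I.card * (C.hs (edges (I ∪ J) j ∪ c) - C.hs c) := by
  rcases I.eq_empty_or_nonempty with rfl | ⟨i₀, hi₀⟩
  · simp [edges]
  · have hne : i₀ ≠ j := fun h => hjI (h ▸ hi₀)
    have hi₀J : i₀ ∉ J := Finset.disjoint_left.1 hIJ hi₀
    have swapJ : ∀ i ∈ I, (edges J j ∪ c).image (Atom.perm (Equiv.swap i i₀)) =
        edges J j ∪ c := by
      intro i hi
      rw [Finset.image_union, image_edges, hc i (Finset.mem_union_left _ hi) i₀ hi₀,
        image_swap_of_notMem (Finset.disjoint_left.1 hIJ hi) hi₀J,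
        Equiv.swap_apply_of_ne_of_ne (fun h => hjI (by rwa [h])) hne.symm]
    have h1 := hC.hs_edges_union_le (hI hi₀) hne hI hjI swapJ
    have h2 := hC.le_hs_edges_union (hI hi₀) hne hi₀J hJ hjJ
      (fun i hi => hc i (Finset.mem_union_right _ hi) i₀ hi₀) le_rfl
    have h3 := hs_union_sub_le (C := C) (edges I j) hc'
    rw [edges_union, Finset.union_assoc]
    set u := C.hs ({Atom.S i₀ j} ∪ (edges J j ∪ c)) - C.hs (edges J j ∪ c)
    have h4 := mul_le_mul_of_nonneg_left h1 (Nat.cast_nonneg (α := ℝ) J.card)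
    have h5 := mul_le_mul_of_nonneg_left h2 (Nat.cast_nonneg (α := ℝ) I.card)
    have h6 := mul_le_mul_of_nonneg_left h3
      (add_nonneg (Nat.cast_nonneg (α := ℝ) I.card) (Nat.cast_nonneg (α := ℝ) J.card))
    linarith

theorem NodeRegen.W_eq (hregen : C.NodeRegen) {j : ℕ} (hj : j ∈ nodes d) {ω ω' : Ω}
    (h : ∀ i ∈ nodes d, i ≠ j → C.S i j ω = C.S i j ω') : C.W j ω = C.W j ω' := by
  obtain ⟨f, hf⟩ := hregen j hj
  rw [hf, hf]
  congr 1
  unfold rv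
  rw [List.map_inj_left]
  intro a ha
  simp only [StoFull, Sto, icc, List.mem_map, List.mem_filter, List.mem_range'_1,
    decide_eq_true_eq] at ha
  obtain ⟨i, ⟨hi, hij⟩, rfl⟩ := ha
  exact h i (Finset.mem_Icc.2 (by omega)) hij

theorem S_eq {i j : ℕ} (hi : i ∈ nodes d) (hj : j ∈ nodes d) (hij : i ≠ j) {ω ω' : Ω}
    (h : C.W i ω = C.W i ω') : C.S i j ω = C.S i j ω' := by
  obtain ⟨f, hf⟩ := C.S_func i hi j hj hij
  rw [hf, hf, h]

theorem MsgRecovery.M_eq {ℓ : ℕ} (hrec : C.MsgRecovery ℓ) {A : Finset ℕ} (hA : A ⊆ nodes d)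
    (hℓ : ℓ < A.card) (hd : A.card ≤ d) {ω ω' : Ω} (h : ∀ i ∈ A, C.W i ω = C.W i ω') :
    C.M A.card ω = C.M A.card ω' := by
  obtain ⟨f, hf⟩ := hrec.2 A hA (Finset.mem_Icc.2 ⟨hℓ, hd⟩)
  rw [hf, hf]
  congr 1
  unfold rv
  rw [List.map_inj_left]
  intro a ha
  simp only [Ws, List.mem_map, Finset.mem_sort] at ha
  obtain ⟨i, hi, rfl⟩ := ha
  exact h i hi

/-- Any `d` nodes determine all nodes. -/
theorem NodeRegen.W_eq_of_card (hregen : C.NodeRegen) {A : Finset ℕ} (hA : A ⊆ nodes d)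
    (hd : A.card = d) {ω ω' : Ω} (h : ∀ i ∈ A, C.W i ω = C.W i ω') :
    ∀ j ∈ nodes d, C.W j ω = C.W j ω' := by
  intro j hj
  by_cases hjA : j ∈ A
  · exact h j hjA
  · refine hregen.W_eq hj fun i hi hij => S_eq hi hj hij (h i ?_)
    have : A = (nodes d).erase j :=
      Finset.eq_of_subset_of_card_le
        (fun x hx => Finset.mem_erase.2 ⟨fun hxj => hjA (hxj ▸ hx), hA hx⟩)
        (by rw [Finset.card_erase_of_mem hj, Nat.card_Icc]; omega)
    rw [this]
    exact Finset.mem_erase.2 ⟨hij, hi⟩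

theorem ker_edges_iff {I : Finset ℕ} {j : ℕ} {ω ω' : Ω} :
    C.ker (edges I j) ω ω' ↔ ∀ i ∈ I, C.S i j ω = C.S i j ω' :=
  Finset.forall_mem_image

theorem ker_union_iff {s t : Finset Atom} {ω ω' : Ω} :
    C.ker (s ∪ t) ω ω' ↔ C.ker s ω ω' ∧ C.ker t ω ω' := by
  rw [ker_union]
  rfl

theorem ker_cfg_iff {ℓ m : ℕ} {A B : Finset ℕ} {ω ω' : Ω} :
    C.ker (cfg d ℓ A B m) ω ω' ↔ (∀ i ∈ A, C.W i ω = C.W i ω') ∧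
      (∀ j ∈ B, ∀ i ∈ nodes d, i ≠ j → C.S i j ω = C.S i j ω') ∧
      ∀ k ∈ Finset.Ioc ℓ m, C.M k ω = C.M k ω' := by
  have hM : C.ker (msgs ℓ m) ω ω' ↔ ∀ k ∈ Finset.Ioc ℓ m, C.M k ω = C.M k ω' :=
    Finset.forall_mem_image
  have hW : C.ker (A.image Atom.W) ω ω' ↔ ∀ i ∈ A, C.W i ω = C.W i ω' :=
    Finset.forall_mem_image
  have hS : C.ker (B.biUnion fun j => edges ((nodes d).erase j) j) ω ω' ↔
      ∀ j ∈ B, ∀ i ∈ nodes d, i ≠ j → C.S i j ω = C.S i j ω' := by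
    constructor
    · intro h j hj i hi hij
      exact h (Atom.S i j) (Finset.mem_biUnion.2
        ⟨j, hj, Finset.mem_image_of_mem _ (Finset.mem_erase.2 ⟨hij, hi⟩)⟩)
    · intro h a ha
      obtain ⟨j, hj, ha⟩ := Finset.mem_biUnion.1 ha
      obtain ⟨i, hi, rfl⟩ := Finset.mem_image.1 ha
      exact h j hj i (Finset.mem_of_mem_erase hi) (Finset.ne_of_mem_erase hi)
  unfold cfg
  rw [ker_union_iff, ker_union_iff, hM, hW, hS, and_assoc]

theorem NodeRegen.W_eq_of_ker_cfg (hregen : C.NodeRegen) {ℓ m : ℕ} {A B : Finset ℕ}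
    (hB : B ⊆ nodes d) {ω ω' : Ω} (h : C.ker (cfg d ℓ A B m) ω ω') :
    ∀ i ∈ A ∪ B, C.W i ω = C.W i ω' := by
  rw [ker_cfg_iff] at h
  intro i hi
  rcases Finset.mem_union.1 hi with hi | hi
  · exact h.1 i hi
  · exact hregen.W_eq (hB hi) (h.2.1 i hi)

theorem cfg_mono {ℓ m : ℕ} {A B A' B' : Finset ℕ} (hA : A ⊆ A') (hB : B ⊆ B') :
    cfg d ℓ A B m ⊆ cfg d ℓ A' B' m :=
  Finset.union_subset_union_left (Finset.union_subset_union (Finset.image_subset_image hA)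
    (Finset.biUnion_subset_biUnion_of_subset_left _ hB))

/-- Repairing one more node only needs the data of the helpers that are not yet known. -/
theorem NodeRegen.hs_cfg_insert (hregen : C.NodeRegen) (ℓ m : ℕ) {A B : Finset ℕ} {j : ℕ}
    (hB : B ⊆ nodes d) (hj : j ∈ nodes d) :
    C.hs (cfg d ℓ A (insert j B) m) =
      C.hs (edges ((nodes d).erase j \ (A ∪ B)) j ∪ cfg d ℓ A B m) := by
  refine hs_congr (fun ω ω' h => ?_) (fun ω ω' h => ?_)
  · rw [ker_union_iff, ker_edges_iff] at h
    have hW := hregen.W_eq_of_ker_cfg hB h.2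
    have h2 := ker_cfg_iff.1 h.2
    refine ker_cfg_iff.2 ⟨h2.1, fun k hk i hi hik => ?_, h2.2.2⟩
    rcases Finset.mem_insert.1 hk with rfl | hk
    · by_cases hiAB : i ∈ A ∪ B
      · exact S_eq hi hj hik (hW i hiAB)
      · exact h.1 i (Finset.mem_sdiff.2 ⟨Finset.mem_erase.2 ⟨hik, hi⟩, hiAB⟩)
    · exact h2.2.1 k hk i hi hik
  · rw [ker_union_iff, ker_edges_iff]
    refine ⟨fun i hi => ?_, ker_le_of_subset
      (cfg_mono (Finset.Subset.refl A) (Finset.subset_insert j B)) h⟩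
    rw [Finset.mem_sdiff, Finset.mem_erase] at hi
    exact (ker_cfg_iff.1 h).2.1 j (Finset.mem_insert_self j B) i hi.1.2 hi.1.1

theorem card_helpers {A B : Finset ℕ} {j : ℕ} (hA : A ⊆ nodes d) (hB : B ⊆ nodes d)
    (hAB : Disjoint A B) (hj : j ∈ nodes d) (hjAB : j ∉ A ∪ B) :
    (((nodes d).erase j \ (A ∪ B)).card : ℝ) = d - A.card - B.card := by
  have hsub : A ∪ B ⊆ (nodes d).erase j :=
    fun x hx => Finset.mem_erase.2 ⟨fun h => hjAB (h ▸ hx), Finset.union_subset hA hB hx⟩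
  have := Finset.card_le_card hsub
  rw [Finset.card_sdiff_of_subset hsub, Nat.cast_sub this, Finset.card_erase_of_mem hj,
    Finset.card_union_of_disjoint hAB, Nat.card_Icc]
  push_cast [Nat.add_sub_cancel]
  ring

theorem image_cfg_swap (ℓ m : ℕ) {A B : Finset ℕ} {i i' : ℕ} (hi : i ∈ nodes d)
    (hi' : i' ∈ nodes d) (hiAB : i ∉ A ∪ B) (hiAB' : i' ∉ A ∪ B) :
    (cfg d ℓ A B m).image (Atom.perm (Equiv.swap i i')) = cfg d ℓ A B m := by
  rw [Finset.mem_union, not_or] at hiAB hiAB'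
  rw [image_cfg (image_swap_of_mem hi hi'), image_swap_of_notMem hiAB.1 hiAB'.1,
    image_swap_of_notMem hiAB.2 hiAB'.2]

theorem repair_exchange (hC : C.Symmetrical) (hregen : C.NodeRegen) (ℓ m : ℕ)
    {A B A' B' : Finset ℕ} {j : ℕ} (hA : A ⊆ A') (hB : B ⊆ B') (hA' : A' ⊆ nodes d)
    (hB' : B' ⊆ nodes d) (hAB' : Disjoint A' B') (hj : j ∈ nodes d) (hjAB : j ∉ A' ∪ B') :
    ((d : ℝ) - A.card - B.card) *
        (C.hs (cfg d ℓ A' (insert j B') m) - C.hs (cfg d ℓ A' B' m)) ≤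
      ((d : ℝ) - A'.card - B'.card) *
        (C.hs (cfg d ℓ A (insert j B) m) - C.hs (cfg d ℓ A B m)) := by
  have hsub : A ∪ B ⊆ A' ∪ B' := Finset.union_subset_union hA hB
  have hjAB₀ : j ∉ A ∪ B := fun h => hjAB (hsub h)
  set I := (nodes d).erase j \ (A' ∪ B') with hI
  set J := (A' ∪ B') \ (A ∪ B) with hJ
  have hIJ : I ∪ J = (nodes d).erase j \ (A ∪ B) := by
    ext x
    have h1 : x ∈ A ∪ B → x ∈ A' ∪ B' := fun h => hsub h
    have h2 : x ∈ A' ∪ B' → x ∈ (nodes d).erase j := fun h =>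
      Finset.mem_erase.2 ⟨fun h' => hjAB (h' ▸ h), Finset.union_subset hA' hB' h⟩
    rw [hI, hJ, Finset.mem_union, Finset.mem_sdiff, Finset.mem_sdiff, Finset.mem_sdiff]
    tauto
  have hdisj : Disjoint I J := by
    rw [Finset.disjoint_left]
    intro x hx hx'
    exact (Finset.mem_sdiff.1 hx).2 (Finset.mem_sdiff.1 hx').1
  have hcI := card_helpers hA' hB' hAB' hj hjAB
  have hcIJ := card_helpers (hA.trans hA') (hB.trans hB')
    (Finset.disjoint_of_subset_left hA (Finset.disjoint_of_subset_right hB hAB')) hj hjAB₀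
  have hmem : ∀ x ∈ I ∪ J, x ∈ nodes d ∧ x ∉ A ∪ B := by
    intro x hx
    rw [hIJ, Finset.mem_sdiff] at hx
    exact ⟨Finset.mem_of_mem_erase hx.1, hx.2⟩
  have key := hC.hs_edges_exchange (c := cfg d ℓ A B m) (c' := cfg d ℓ A' B' m) (j := j)
    (I := I) (J := J) (fun x hx => (hmem x (Finset.mem_union_left _ hx)).1)
    (fun x hx => (hmem x (Finset.mem_union_right _ hx)).1) hdisj
    (fun h => by simp [hI] at h)
    (fun h => hjAB (Finset.mem_sdiff.1 h).1)
    (fun i hi i' hi' => image_cfg_swap ℓ m (hmem i hi).1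
      (hmem i' (Finset.mem_union_left _ hi')).1 (hmem i hi).2
      (hmem i' (Finset.mem_union_left _ hi')).2) ?_
  · rw [hregen.hs_cfg_insert ℓ m hB' hj,
      hregen.hs_cfg_insert ℓ m (hB.trans hB') hj, ← hIJ, ← hcI, ← hcIJ, ← hIJ,
      Finset.card_union_of_disjoint hdisj]
    push_cast
    exact key
  · intro ω ω' h
    rw [ker_union_iff, ker_edges_iff]
    have hW := hregen.W_eq_of_ker_cfg hB' h
    refine ⟨fun i hi => ?_, ker_le_of_subset (cfg_mono hA hB) h⟩
    exact S_eq (hmem i (Finset.mem_union_right _ hi)).1 hj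
      (fun hij => hjAB (hij ▸ (Finset.mem_sdiff.1 hi).1)) (hW i (Finset.mem_sdiff.1 hi).1)

variable (C) in
/-- Joint entropy of the contents of `a` nodes, the repair data of `b` other nodes and the
messages `M_{ℓ+1}, …, M_m`. -/
def F (ℓ a b m : ℕ) : ℝ := C.hs (cfg d ℓ (Finset.Icc 1 a) (Finset.Ioc a (a + b)) m)

theorem Symmetrical.hs_cfg (hC : C.Symmetrical) (ℓ m : ℕ) {A B : Finset ℕ}
    (hA : A ⊆ nodes d) (hB : B ⊆ nodes d) (hAB : Disjoint A B) :
    C.hs (cfg d ℓ A B m) = C.F ℓ A.card B.card m := by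
  have hle : A.card + B.card ≤ d + 1 := by
    rw [← Finset.card_union_of_disjoint hAB]
    simpa using Finset.card_le_card (Finset.union_subset hA hB)
  refine hC.hs_cfg_eq ℓ m hA hB ?_ ?_ hAB ?_ (by simp) (by simp)
  · exact fun x hx => by rw [Finset.mem_Icc] at *; omega
  · exact fun x hx => by rw [Finset.mem_Icc]; rw [Finset.mem_Ioc] at hx; omega
  · rw [Finset.disjoint_left]
    exact fun x hx hx' => by rw [Finset.mem_Icc] at hx; rw [Finset.mem_Ioc] at hx'; omega

theorem F_exchange (hC : C.Symmetrical) (hregen : C.NodeRegen) (ℓ m : ℕ) {a b a' b' : ℕ}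
    (ha : a ≤ a') (hb : b ≤ b') (hd : a' + b' ≤ d) :
    ((d : ℝ) - a - b) * (C.F ℓ a' (b' + 1) m - C.F ℓ a' b' m) ≤
      ((d : ℝ) - a' - b') * (C.F ℓ a (b + 1) m - C.F ℓ a b m) := by
  have hj : a' + b' + 1 ∈ nodes d := Finset.mem_Icc.2 (by omega)
  have hA' : Finset.Icc 1 a' ⊆ nodes d := Finset.Icc_subset_Icc_right (by omega)
  have hA : Finset.Icc 1 a ⊆ Finset.Icc 1 a' := Finset.Icc_subset_Icc_right ha
  have hB' : Finset.Ioc a' (a' + b') ⊆ nodes d := fun x hx => by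
    rw [Finset.mem_Icc]; rw [Finset.mem_Ioc] at hx; omega
  have hB : Finset.Ioc a' (a' + b) ⊆ Finset.Ioc a' (a' + b') :=
    Finset.Ioc_subset_Ioc_right (by omega)
  have hAB' : Disjoint (Finset.Icc 1 a') (Finset.Ioc a' (a' + b')) := by
    rw [Finset.disjoint_left]
    exact fun x hx hx' => by rw [Finset.mem_Icc] at hx; rw [Finset.mem_Ioc] at hx'; omega
  have hAB : Disjoint (Finset.Icc 1 a) (Finset.Ioc a' (a' + b)) :=
    Finset.disjoint_of_subset_left hA (Finset.disjoint_of_subset_right hB hAB')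
  have hjA' : a' + b' + 1 ∉ Finset.Icc 1 a' := by rw [Finset.mem_Icc]; omega
  have hjB' : a' + b' + 1 ∉ Finset.Ioc a' (a' + b') := by rw [Finset.mem_Ioc]; omega
  have h := repair_exchange hC hregen ℓ m hA hB hA' hB' hAB' hj
    (by rw [Finset.mem_union]; exact not_or.2 ⟨hjA', hjB'⟩)
  rw [hC.hs_cfg ℓ m hA' hB' hAB', hC.hs_cfg ℓ m (hA.trans hA') (hB.trans hB') hAB,
    hC.hs_cfg ℓ m hA' (Finset.insert_subset hj hB')
      (Finset.disjoint_insert_right.2 ⟨hjA', hAB'⟩),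
    hC.hs_cfg ℓ m (hA.trans hA') (Finset.insert_subset hj (hB.trans hB'))
      (Finset.disjoint_insert_right.2 ⟨fun h => hjA' (hA h), hAB⟩),
    Finset.card_insert_of_notMem hjB', Finset.card_insert_of_notMem fun h => hjB' (hB h)] at h
  simpa using h

theorem T_self (d k : ℕ) : T d k k = 0 := by simp [T]

theorem T_succ (d : ℕ) {k ℓ : ℕ} (h : ℓ ≤ k) : T d (k + 1) ℓ = T d k ℓ + (d - k) := by
  unfold T
  rw [← Finset.insert_Icc_right_eq_Icc_add_one (by omega), Finset.sum_insert (by simp)]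
  push_cast
  ring

theorem T_add (d : ℕ) {k m ℓ : ℕ} (h : ℓ ≤ k) (h' : k ≤ m) :
    T d m ℓ = T d k ℓ + T d m k := by
  induction m, h' using Nat.le_induction with
  | base => simp [T_self]
  | succ m h' ih => rw [T_succ d (h.trans h'), T_succ d h', ih, add_assoc]

theorem T_pos {k ℓ : ℕ} (h : ℓ < k) (hk : k ≤ d) : 0 < T d k ℓ := by
  refine Finset.sum_pos (fun t ht => ?_) ⟨k, Finset.mem_Icc.2 (by omega)⟩
  rw [Finset.mem_Icc] at ht
  have : (t : ℝ) ≤ d := by exact_mod_cast ht.2.trans hk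
  linarith

theorem T_mul_le_F_sub (hC : C.Symmetrical) (hregen : C.NodeRegen) (ℓ m : ℕ)
    {a b n a' b' : ℕ} (ha : a ≤ a') (hb : b + n ≤ b' + 1) (hd : a' + b' ≤ d) :
    T d (a + b + n) (a + b) * (C.F ℓ a' (b' + 1) m - C.F ℓ a' b' m) ≤
      ((d : ℝ) - a' - b') * (C.F ℓ a (b + n) m - C.F ℓ a b m) := by
  induction n with
  | zero => simp [T_self]
  | succ n ih =>
    have h1 := ih (by omega)
    have h2 := F_exchange hC hregen ℓ m ha (show b + n ≤ b' by omega) hd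
    rw [← add_assoc, ← add_assoc, T_succ d (by omega)]
    push_cast at h2 ⊢
    linarith

theorem F_succ_sub_le (hregen : C.NodeRegen) (ℓ m : ℕ) {a b : ℕ}
    (hd : a + b ≤ d) {β : ℝ}
    (hβ : ∀ i ∈ nodes d, ∀ j ∈ nodes d, i ≠ j → C.HL [Atom.S i j] ≤ β) :
    C.F ℓ a (b + 1) m - C.F ℓ a b m ≤ ((d : ℝ) - a - b) * β := by
  have hj : a + b + 1 ∈ nodes d := Finset.mem_Icc.2 (by omega)
  have hA : Finset.Icc 1 a ⊆ nodes d := Finset.Icc_subset_Icc_right (by omega)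
  have hB : Finset.Ioc a (a + b) ⊆ nodes d := fun x hx => by
    rw [Finset.mem_Icc]; rw [Finset.mem_Ioc] at hx; omega
  have hAB : Disjoint (Finset.Icc 1 a) (Finset.Ioc a (a + b)) := by
    rw [Finset.disjoint_left]
    exact fun x hx hx' => by rw [Finset.mem_Icc] at hx; rw [Finset.mem_Ioc] at hx'; omega
  have hins : Finset.Ioc a (a + (b + 1)) = insert (a + b + 1) (Finset.Ioc a (a + b)) := by
    rw [Finset.insert_Ioc_right_eq_Ioc_add_one (by omega), add_assoc]
  have hcard := card_helpers hA hB hAB hj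
    (by rw [Finset.mem_union, Finset.mem_Icc, Finset.mem_Ioc]; omega)
  rw [Nat.card_Icc, Nat.card_Ioc, Nat.add_sub_cancel, Nat.add_sub_cancel_left] at hcard
  have hedges : ∀ I : Finset ℕ, I ⊆ (nodes d).erase (a + b + 1) →
      C.hs (edges I (a + b + 1)) ≤ I.card * β := by
    intro I
    induction I using Finset.induction_on with
    | empty => simp [edges, hs_empty]
    | insert i I hi ih =>
      intro hI
      have h1 := ih ((Finset.subset_insert i I).trans hI)
      have h2 := Finset.mem_erase.1 (hI (Finset.mem_insert_self i I))
      have h3 := hβ i h2.2 _ hj h2.1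
      have h4 := C.hs_union_le {Atom.S i (a + b + 1)} (edges I (a + b + 1))
      rw [HL_singleton] at h3
      rw [edges_insert, Finset.card_insert_of_notMem hi]
      push_cast
      linarith
  unfold F
  rw [hins, hregen.hs_cfg_insert ℓ m hB hj, ← hcard]
  have h2 := C.hs_union_le (edges ((nodes d).erase (a + b + 1) \
    (Finset.Icc 1 a ∪ Finset.Ioc a (a + b))) (a + b + 1))
    (cfg d ℓ (Finset.Icc 1 a) (Finset.Ioc a (a + b)) m)
  exact sub_le_iff_le_add.2 (h2.trans (add_le_add (hedges _ Finset.sdiff_subset) le_rfl))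

theorem F_add_sub_le (hregen : C.NodeRegen) (ℓ m : ℕ) {a b n : ℕ}
    (hd : a + b + n ≤ d + 1) {β : ℝ}
    (hβ : ∀ i ∈ nodes d, ∀ j ∈ nodes d, i ≠ j → C.HL [Atom.S i j] ≤ β) :
    C.F ℓ a (b + n) m - C.F ℓ a b m ≤ T d (a + b + n) (a + b) * β := by
  induction n with
  | zero => simp [T_self]
  | succ n ih =>
    have h1 := ih (by omega)
    have h2 := F_succ_sub_le hregen ℓ m (show a + (b + n) ≤ d by omega) hβ
    rw [← add_assoc, ← add_assoc, T_succ d (by omega)]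
    push_cast at h2 ⊢
    linarith

/-- Lower bound on the entropy of the data sent by one node to at most `ℓ₂` other nodes. -/
theorem card_mul_le_hs_sent (hC : C.Symmetrical) (hregen : C.NodeRegen) {ℓ₁ ℓ₂ : ℕ} (ℓ m : ℕ)
    (hd : ℓ₁ + ℓ₂ < d) {p : ℕ} (hp : p ∈ nodes d) {K : Finset ℕ} (hK : K ⊆ nodes d)
    (hpK : p ∉ K) (hcard : K.card ≤ ℓ₂) :
    K.card * (C.F ℓ ℓ₁ (ℓ₂ + 1) m - C.F ℓ ℓ₁ ℓ₂ m) ≤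
      ((d : ℝ) - ℓ₁ - ℓ₂) * C.hs (K.image (Atom.S p)) := by
  induction K using Finset.induction_on with
  | empty => simp [hs_empty]
  | insert j K hjK ih =>
    rw [Finset.card_insert_of_notMem hjK] at hcard
    have hKN : K ⊆ nodes d := (Finset.subset_insert j K).trans hK
    have hpK' : p ∉ K := fun h => hpK (Finset.mem_insert_of_mem h)
    have hpj : p ≠ j := fun h => hpK (h ▸ Finset.mem_insert_self j K)
    have hj : j ∈ nodes d := hK (Finset.mem_insert_self j K)
    have h1 := ih hKN hpK' (by omega)
    have hcN : (((nodes d).erase p).erase j).card = d - 1 := by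
      rw [Finset.card_erase_of_mem (Finset.mem_erase.2 ⟨hpj.symm, hj⟩),
        Finset.card_erase_of_mem hp, Nat.card_Icc]
      omega
    have hKsub : K ⊆ ((nodes d).erase p).erase j := fun x hx =>
      Finset.mem_erase.2 ⟨fun h => hjK (h ▸ hx),
        Finset.mem_erase.2 ⟨fun h => hpK' (h ▸ hx), hKN hx⟩⟩
    obtain ⟨B, hKB, hBsub, hBcard⟩ := Finset.exists_subsuperset_card_eq hKsub
      (show K.card ≤ ℓ₂ by omega) (by omega)
    obtain ⟨A, hAsub, hAcard⟩ := Finset.exists_subset_card_eq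
      (s := ((nodes d).erase p).erase j \ B) (n := ℓ₁)
      (by rw [Finset.card_sdiff_of_subset hBsub]; omega)
    have hmem : ∀ x ∈ ((nodes d).erase p).erase j, x ≠ j ∧ x ≠ p ∧ x ∈ nodes d := by
      intro x hx
      simpa only [Finset.mem_erase] using hx
    have hA : ∀ x ∈ A, x ≠ j ∧ x ≠ p ∧ x ∈ nodes d := fun x hx =>
      hmem x (Finset.mem_sdiff.1 (hAsub hx)).1
    have hB : ∀ x ∈ B, x ≠ j ∧ x ≠ p ∧ x ∈ nodes d := fun x hx => hmem x (hBsub hx)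
    have hAB : Disjoint A B := by
      rw [Finset.disjoint_left]
      exact fun x hx => (Finset.mem_sdiff.1 (hAsub hx)).2
    have hAN : A ⊆ nodes d := fun x hx => (hA x hx).2.2
    have hBN : B ⊆ nodes d := fun x hx => (hB x hx).2.2
    have hjA : j ∉ A := fun h => (hA j h).1 rfl
    have hjB : j ∉ B := fun h => (hB j h).1 rfl
    have hjAB : j ∉ A ∪ B := by simp [hjA, hjB]
    have hpAB : p ∉ A ∪ B := by
      rw [Finset.mem_union, not_or]
      exact ⟨fun h => (hA p h).2.1 rfl, fun h => (hB p h).2.1 rfl⟩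
    have h2 := hC.hs_edges_union_le (c := cfg d ℓ A B m) (i₀ := p) (j := j)
      (K := (nodes d).erase j \ (A ∪ B)) hp hpj
      (fun x hx => Finset.mem_of_mem_erase (Finset.mem_sdiff.1 hx).1) (by simp)
      (fun i hi => image_cfg_swap ℓ m (Finset.mem_of_mem_erase (Finset.mem_sdiff.1 hi).1) hp
        (Finset.mem_sdiff.1 hi).2 hpAB)
    rw [← hregen.hs_cfg_insert ℓ m hBN hj, hC.hs_cfg ℓ m hAN hBN hAB,
      hC.hs_cfg ℓ m hAN (Finset.insert_subset hj hBN)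
        (Finset.disjoint_insert_right.2 ⟨hjA, hAB⟩),
      Finset.card_insert_of_notMem hjB, card_helpers hAN hBN hAB hj hjAB, hAcard,
      hBcard] at h2
    have hker : C.ker (cfg d ℓ A B m) ≤ C.ker (K.image (Atom.S p)) := by
      intro ω ω' h a ha
      obtain ⟨k, hk, rfl⟩ := Finset.mem_image.1 ha
      exact (ker_cfg_iff.1 h).2.1 k (hKB hk) p hp fun hpk => hpK' (hpk ▸ hk)
    have h3 := hs_union_sub_le {Atom.S p j} hker
    rw [hC.hs_cfg ℓ m hAN hBN hAB, hAcard, hBcard] at h3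
    have h4 : (0 : ℝ) ≤ (d : ℝ) - ℓ₁ - ℓ₂ := by
      have : ((ℓ₁ + ℓ₂ : ℕ) : ℝ) ≤ d := by exact_mod_cast hd.le
      push_cast at this
      linarith
    have h5 := mul_le_mul_of_nonneg_left h3 h4
    rw [Finset.card_insert_of_notMem hjK, Finset.image_insert, Finset.insert_eq]
    push_cast
    linarith

theorem msgs_union {a b c : ℕ} (hab : a ≤ b) (hbc : b ≤ c) :
    msgs a b ∪ msgs b c = msgs a c := by
  unfold msgs
  rw [← Finset.image_union, Finset.Ioc_union_Ioc_eq_Ioc hab hbc]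

variable (C) in
theorem sum_le_hs_msgs {ℓ : ℕ} (hℓ : ℓ ≤ d) :
    ∑ j ∈ Finset.Ioc ℓ d, C.hs {Atom.M j} ≤ C.hs (msgs ℓ d) := by
  have h1 := C.hs_msgs
  have h2 := C.hs_union_le (msgs 0 ℓ) (msgs ℓ d)
  have h3 := C.hs_union_msgs_le ∅ (le_refl 0) (Nat.zero_le ℓ)
  have h4 : C.hs (∅ ∪ msgs 0 0) = 0 := by
    rw [show ∅ ∪ msgs 0 0 = ∅ by simp [msgs], hs_empty]
  rw [Finset.empty_union, h4] at h3
  rw [msgs_union (Nat.zero_le ℓ) hℓ] at h2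
  have h5 := Finset.sum_Ioc_consecutive (fun j => C.hs {Atom.M j}) (Nat.zero_le ℓ) hℓ
  linarith

theorem toFinset_MsL (a b : ℕ) : (MsL (icc (a + 1) b)).toFinset = msgs a b := by
  ext x
  simp only [MsL, icc, msgs, List.mem_toFinset, List.mem_map, List.mem_range'_1,
    Finset.mem_image, Finset.mem_Ioc]
  exact exists_congr fun k => and_congr_left fun _ => by omega

theorem toFinset_Ws_append (d ℓ : ℕ) (A B : Finset ℕ) :
    (Ws (A.sort (· ≤ ·)) ++ StoFullL d (B.sort (· ≤ ·))).toFinset = cfg d ℓ A B ℓ := by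
  ext x
  simp only [Ws, StoFullL, StoFull, Sto, icc, cfg, msgs, edges, List.mem_toFinset,
    List.mem_append, List.mem_map, List.mem_flatten, Finset.mem_sort, Finset.mem_union,
    Finset.mem_image, Finset.mem_biUnion, Finset.Ioc_self, Finset.notMem_empty, false_and,
    exists_false, or_false, exists_exists_and_eq_and, List.mem_filter, List.mem_range'_1,
    decide_eq_true_eq, Finset.mem_erase, Finset.mem_Icc]
  refine or_congr_right (exists_congr fun j => and_congr_right fun _ => exists_congr fun i =>
    and_congr_left fun _ => ?_)
  rw [and_comm]
  exact and_congr_right fun _ => by omega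

/-- Repair secrecy makes the messages contribute their full entropy. -/
theorem RepairSecrecy.F_eq {ℓ₁ ℓ₂ ℓ : ℕ} (hsec : C.RepairSecrecy ℓ₁ ℓ₂) (hℓ : ℓ = ℓ₁ + ℓ₂)
    {m : ℕ} (hm : ℓ ≤ m) (hmd : m ≤ d) :
    C.F ℓ ℓ₁ ℓ₂ m = C.F ℓ ℓ₁ ℓ₂ ℓ + ∑ j ∈ Finset.Ioc ℓ m, C.hs {Atom.M j} := by
  have h := hsec (Finset.Icc 1 ℓ₁) (Finset.Ioc ℓ₁ (ℓ₁ + ℓ₂))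
    (Finset.Icc_subset_Icc_right (by omega))
    (fun x hx => by rw [Finset.mem_Icc]; rw [Finset.mem_Ioc] at hx; omega)
    (by
      rw [Finset.disjoint_left]
      exact fun x hx hx' => by rw [Finset.mem_Icc] at hx; rw [Finset.mem_Ioc] at hx'; omega)
    (by simp) (by simp)
  unfold MI at h
  rw [HL_eq_hs, HL_eq_hs, HL_eq_hs, List.toFinset_append (l := MsL _), toFinset_MsL,
    toFinset_Ws_append d ℓ, ← hℓ] at h
  have hcfg : msgs ℓ d ∪ cfg d ℓ (Finset.Icc 1 ℓ₁) (Finset.Ioc ℓ₁ ℓ) ℓ =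
      cfg d ℓ (Finset.Icc 1 ℓ₁) (Finset.Ioc ℓ₁ ℓ) d := by
    unfold cfg
    rw [Finset.union_comm, Finset.union_assoc, msgs_union le_rfl (hm.trans hmd)]
  have h1 := C.hs_union_msgs_le ((Finset.Icc 1 ℓ₁).image Atom.W ∪
    (Finset.Ioc ℓ₁ ℓ).biUnion fun j => edges ((nodes d).erase j) j) hm hmd
  have h2 := C.hs_union_msgs_le ((Finset.Icc 1 ℓ₁).image Atom.W ∪
    (Finset.Ioc ℓ₁ ℓ).biUnion fun j => edges ((nodes d).erase j) j) (le_refl ℓ) hm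
  have h3 := C.sum_le_hs_msgs (hm.trans hmd)
  have h4 := Finset.sum_Ioc_consecutive (fun j => C.hs {Atom.M j}) hm hmd
  unfold F
  rw [hcfg] at h
  rw [← hℓ]
  unfold cfg at h ⊢
  linarith

/-- The contents of `m + 1` nodes determine the message `M_{m+1}`. -/
theorem MsgRecovery.F_succ {ℓ : ℕ} (hrec : C.MsgRecovery ℓ) (hregen : C.NodeRegen)
    {a b m : ℕ} (hab : a + b = m + 1) (hm : ℓ ≤ m) (hmd : m < d) :
    C.F ℓ a b (m + 1) = C.F ℓ a b m := by
  have hB : Finset.Ioc a (a + b) ⊆ nodes d := fun x hx => by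
    rw [Finset.mem_Icc]; rw [Finset.mem_Ioc] at hx; omega
  refine hs_congr (fun ω ω' h => ?_) (ker_le_of_subset ?_)
  · have hW := hregen.W_eq_of_ker_cfg hB h
    have h' := ker_cfg_iff.1 h
    refine ker_cfg_iff.2 ⟨h'.1, h'.2.1, fun k hk => ?_⟩
    rw [Finset.mem_Ioc] at hk
    rcases hk.2.lt_or_eq with hk' | rfl
    · exact h'.2.2 k (Finset.mem_Ioc.2 ⟨hk.1, by omega⟩)
    · have hcard : (Finset.Icc 1 (m + 1)).card = m + 1 := by simp
      have := hrec.M_eq (A := Finset.Icc 1 (m + 1)) (Finset.Icc_subset_Icc_right (by omega))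
        (by omega) (by omega) (ω := ω) (ω' := ω') fun i hi => hW i (by
          rw [Finset.mem_Icc] at hi
          rw [Finset.mem_union, Finset.mem_Icc, Finset.mem_Ioc]
          omega)
      rwa [hcard] at this
  · exact Finset.union_subset_union_right
      (Finset.image_subset_image (Finset.Ioc_subset_Ioc_right (by omega)))

/-- Any `d` nodes carry all node contents and repair data. -/
theorem NodeRegen.F_le (hregen : C.NodeRegen) (ℓ m : ℕ) {a b a' b' : ℕ}
    (hab : a + b ≤ d + 1) (hab' : a' + b' = d) : C.F ℓ a b m ≤ C.F ℓ a' b' m := by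
  have hB' : Finset.Ioc a' (a' + b') ⊆ nodes d := fun x hx => by
    rw [Finset.mem_Icc]; rw [Finset.mem_Ioc] at hx; omega
  refine hs_mono fun ω ω' h => ?_
  have hW := hregen.W_eq_of_card (A := Finset.Icc 1 d) (ω := ω) (ω' := ω')
    (Finset.Icc_subset_Icc_right (by omega)) (by simp) fun i hi =>
      hregen.W_eq_of_ker_cfg hB' h i (by
        rw [Finset.mem_Icc] at hi
        rw [Finset.mem_union, Finset.mem_Icc, Finset.mem_Ioc]
        omega)
  refine ker_cfg_iff.2 ⟨fun i hi => hW i ?_, fun j hj i hi hij => S_eq hi ?_ hij (hW i hi),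
    (ker_cfg_iff.1 h).2.2⟩
  · rw [Finset.mem_Icc] at hi ⊢
    omega
  · rw [Finset.mem_Icc]
    rw [Finset.mem_Ioc] at hj
    omega

variable (C) in
/-- Joint entropy of the contents of the first `a` nodes and the data the next node sends to
repair them. -/
def sentEntropy (a : ℕ) : ℝ :=
  C.hs ((Finset.Icc 1 a).image (Atom.S (a + 1)) ∪ (Finset.Icc 1 a).image Atom.W)

theorem F_succ_zero_le (ℓ : ℕ) {a : ℕ} (ha : a ≤ d) :
    C.F ℓ (a + 1) 0 ℓ ≤ C.sentEntropy a + C.hs {Atom.W (a + 1)} -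
      C.hs ((Finset.Icc 1 a).image (Atom.S (a + 1))) := by
  have h1 := hs_union_sub_le (C := C) {Atom.W (a + 1)} (ker_le_of_subset
    (Finset.subset_union_left (s₁ := (Finset.Icc 1 a).image (Atom.S (a + 1)))
      (s₂ := (Finset.Icc 1 a).image Atom.W)))
  have h2 : C.hs ({Atom.W (a + 1)} ∪ (Finset.Icc 1 a).image (Atom.S (a + 1))) ≤
      C.hs {Atom.W (a + 1)} := by
    refine hs_mono fun ω ω' h => ker_union_iff.2 ⟨h, fun x hx => ?_⟩
    obtain ⟨j, hj, rfl⟩ := Finset.mem_image.1 hx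
    rw [Finset.mem_Icc] at hj
    exact S_eq (Finset.mem_Icc.2 (by omega)) (Finset.mem_Icc.2 (by omega)) (by omega)
      (h _ (Finset.mem_singleton_self _))
  have h3 : C.F ℓ (a + 1) 0 ℓ ≤ C.hs ({Atom.W (a + 1)} ∪
      ((Finset.Icc 1 a).image (Atom.S (a + 1)) ∪ (Finset.Icc 1 a).image Atom.W)) := by
    refine hs_mono (ker_le_of_subset fun x hx => ?_)
    simp only [cfg, msgs, add_zero, Finset.Ioc_self, Finset.biUnion_empty, Finset.image_empty,
      Finset.union_empty] at hx
    rw [← Finset.insert_Icc_right_eq_Icc_add_one (by omega), Finset.image_insert,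
      Finset.mem_insert] at hx
    simp only [Finset.mem_union, Finset.mem_singleton]
    tauto
  unfold sentEntropy
  linarith

theorem NodeRegen.sentEntropy_add_le (hC : C.Symmetrical) (hregen : C.NodeRegen) (ℓ : ℕ)
    {a : ℕ} (ha : a ≤ d) :
    C.sentEntropy a + (C.F ℓ 0 (a + 1) ℓ - C.F ℓ 0 a ℓ) ≤ C.F ℓ a 1 ℓ := by
  have hp : a + 1 ∈ nodes d := Finset.mem_Icc.2 (by omega)
  have hB : Finset.Icc 1 a ⊆ nodes d := Finset.Icc_subset_Icc_right (by omega)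
  have hpB : a + 1 ∉ Finset.Icc 1 a := by rw [Finset.mem_Icc]; omega
  have hmem : ∀ j ∈ Finset.Icc 1 a, j ∈ nodes d ∧ a + 1 ≠ j := fun j hj =>
    ⟨hB hj, fun h => hpB (h ▸ hj)⟩
  have hker : C.ker (cfg d ℓ ∅ (Finset.Icc 1 a) ℓ) ≤
      C.ker ((Finset.Icc 1 a).image (Atom.S (a + 1)) ∪ (Finset.Icc 1 a).image Atom.W) := by
    intro ω ω' h
    refine ker_union_iff.2 ⟨?_, ?_⟩
    · exact Finset.forall_mem_image.2 fun j hj =>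
        (ker_cfg_iff.1 h).2.1 j hj _ hp (hmem j hj).2
    · exact Finset.forall_mem_image.2 fun j hj =>
        hregen.W_eq_of_ker_cfg hB h j (Finset.mem_union_right _ hj)
  have h1 := hs_union_sub_le (edges ((nodes d).erase (a + 1)) (a + 1)) hker
  have h2 : C.hs (cfg d ℓ ∅ (insert (a + 1) (Finset.Icc 1 a)) ℓ) ≤
      C.hs (edges ((nodes d).erase (a + 1)) (a + 1) ∪ cfg d ℓ ∅ (Finset.Icc 1 a) ℓ) := by
    rw [hregen.hs_cfg_insert ℓ ℓ hB hp]
    exact hs_mono (ker_le_of_subset (Finset.union_subset_union_left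
      (Finset.image_subset_image Finset.sdiff_subset)))
  have h3 : C.hs (edges ((nodes d).erase (a + 1)) (a + 1) ∪
      ((Finset.Icc 1 a).image (Atom.S (a + 1)) ∪ (Finset.Icc 1 a).image Atom.W)) ≤
      C.F ℓ a 1 ℓ := by
    refine hs_mono fun ω ω' h => ?_
    have h' := ker_cfg_iff.1 h
    have hself : a + 1 ∈ Finset.Ioc a (a + 1) := Finset.mem_Ioc.2 (by omega)
    have hW : C.W (a + 1) ω = C.W (a + 1) ω' := hregen.W_eq hp (h'.2.1 _ hself)
    refine ker_union_iff.2 ⟨ker_edges_iff.2 fun i hi => ?_, ker_union_iff.2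
      ⟨Finset.forall_mem_image.2 fun j hj => ?_, Finset.forall_mem_image.2 h'.1⟩⟩
    · rw [Finset.mem_erase] at hi
      exact h'.2.1 _ hself i hi.2 hi.1
    · exact S_eq hp (hmem j hj).1 (hmem j hj).2 hW
  rw [hC.hs_cfg ℓ ℓ (Finset.empty_subset _) hB (Finset.disjoint_empty_left _)] at h1
  rw [hC.hs_cfg ℓ ℓ (Finset.empty_subset _) (Finset.insert_subset hp hB)
    (Finset.disjoint_empty_left _), Finset.card_insert_of_notMem hpB] at h2
  simp only [Finset.card_empty, Nat.card_Icc, Nat.add_sub_cancel] at h1 h2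
  unfold sentEntropy
  linarith

/-- Normalised message rates bound the increments of the joint entropy from below. -/
theorem F_sub_le_of_rates (hC : C.Symmetrical) (hregen : C.NodeRegen) {ℓ₁ ℓ₂ ℓ : ℕ}
    (hℓ : ℓ = ℓ₁ + ℓ₂) (hrec : C.MsgRecovery ℓ) (hsec : C.RepairSecrecy ℓ₁ ℓ₂) {k : ℕ}
    (hk : ℓ + 1 + k ≤ d) {u : ℝ}
    (hu : ((d : ℝ) - ℓ) * u = C.F ℓ ℓ₁ (ℓ₂ + 1) ℓ - C.F ℓ ℓ₁ ℓ₂ ℓ) :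
    C.F ℓ ℓ₁ (ℓ₂ + 1 + k) (ℓ + 1 + k) - C.F ℓ ℓ₁ ℓ₂ (ℓ + 1 + k) ≤
      T d (ℓ + 1 + k) ℓ *
        (u - ∑ j ∈ Finset.Ioc ℓ (ℓ + 1 + k), (T d j ℓ)⁻¹ * C.hs {Atom.M j}) := by
  induction k with
  | zero =>
    have h1 := hsec.F_eq hℓ (m := ℓ + 1) (by omega) (by omega)
    have h2 := hrec.F_succ hregen (a := ℓ₁) (b := ℓ₂ + 1) (m := ℓ) (by omega) le_rfl (by omega)
    have hT : T d (ℓ + 1) ℓ = (d : ℝ) - ℓ := by rw [T_succ d le_rfl, T_self, zero_add]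
    have hpos := T_pos (d := d) (k := ℓ + 1) (ℓ := ℓ) (by omega) (by omega)
    simp only [add_zero, Nat.Ioc_succ_singleton, Finset.sum_singleton] at h1 ⊢
    rw [mul_sub, mul_inv_cancel_left₀ hpos.ne', hT, hu]
    linarith
  | succ k ih =>
    have ih := ih (by omega)
    set m := ℓ + 1 + k with hm
    have h1 := hsec.F_eq hℓ (m := m) (by omega) (by omega)
    have h2 := hsec.F_eq hℓ (m := m + 1) (by omega) (by omega)
    have h3 := hrec.F_succ hregen (a := ℓ₁) (b := ℓ₂ + 1 + k + 1) (m := m) (by omega) (by omega)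
      (by omega)
    have h4 := T_mul_le_F_sub hC hregen ℓ m (a := ℓ₁) (b := ℓ₂) (n := 1 + k) (a' := ℓ₁)
      (b' := ℓ₂ + 1 + k) le_rfl (by omega) (by omega)
    have hposm := T_pos (d := d) (k := m) (ℓ := ℓ) (by omega) (by omega)
    have hposm' := T_pos (d := d) (k := m + 1) (ℓ := ℓ) (by omega) (by omega)
    have hT := T_succ d (show ℓ ≤ m by omega)
    have hmcast : (m : ℝ) = ℓ₁ + (ℓ₂ + 1 + k) := by rw [hm, hℓ]; push_cast; ring
    rw [show ℓ₁ + ℓ₂ + (1 + k) = m by omega, ← hℓ,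
      show ℓ₂ + (1 + k) = ℓ₂ + 1 + k by omega] at h4
    push_cast at h4
    rw [← add_assoc, ← add_assoc,
      ← Finset.insert_Ioc_right_eq_Ioc_add_one (show ℓ ≤ m by omega), Finset.sum_insert (by simp)]
    rw [← Finset.insert_Ioc_right_eq_Ioc_add_one (show ℓ ≤ m by omega),
      Finset.sum_insert (by simp)] at h2
    set x := ∑ j ∈ Finset.Ioc ℓ m, (T d j ℓ)⁻¹ * C.hs {Atom.M j}
    have h5 := mul_inv_cancel_left₀ hposm'.ne' (C.hs {Atom.M (m + 1)})
    have h6 := mul_le_mul_of_nonneg_left ih hposm'.le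
    rw [show (d : ℝ) - ℓ₁ - (ℓ₂ + 1 + k) = T d (m + 1) ℓ - T d m ℓ by
      rw [hT, hmcast]; ring] at h4
    have h7 : T d (m + 1) ℓ * (u - ((T d (m + 1) ℓ)⁻¹ * C.hs {Atom.M (m + 1)} + x)) =
        T d (m + 1) ℓ * (u - x) - C.hs {Atom.M (m + 1)} := by
      linear_combination -h5
    refine le_of_mul_le_mul_left ?_ hposm
    rw [← hm, h7, h3, h2]
    rw [h1] at h4 h6
    linarith

/-- The chain of entropies with one more node exposed, combined with the message rates. -/
theorem F_succ_le_of_rates (hC : C.Symmetrical) (hregen : C.NodeRegen) {ℓ₁ ℓ₂ ℓ : ℕ}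
    (hℓ : ℓ = ℓ₁ + ℓ₂) (hrec : C.MsgRecovery ℓ) (hsec : C.RepairSecrecy ℓ₁ ℓ₂) {k : ℕ}
    (hk : ℓ + 1 + k ≤ d) {u β : ℝ}
    (hu : ((d : ℝ) - ℓ) * u = C.F ℓ ℓ₁ (ℓ₂ + 1) ℓ - C.F ℓ ℓ₁ ℓ₂ ℓ) (huβ : u ≤ β) :
    C.F ℓ (ℓ₁ + 1) (ℓ₂ + k) (ℓ + 1 + k) ≤
      C.F ℓ (ℓ₁ + 1) ℓ₂ ℓ + T d (ℓ + 1 + k) (ℓ + 1) * β -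
        T d (ℓ + 1 + k) ℓ * ∑ j ∈ Finset.Ioc ℓ (ℓ + 1 + k), (T d j ℓ)⁻¹ * C.hs {Atom.M j} +
        ∑ j ∈ Finset.Ioc ℓ (ℓ + 1 + k), C.hs {Atom.M j} := by
  induction k with
  | zero =>
    have h1 := hrec.F_succ hregen (a := ℓ₁ + 1) (b := ℓ₂) (m := ℓ) (by omega) le_rfl (by omega)
    have hpos := T_pos (d := d) (k := ℓ + 1) (ℓ := ℓ) (by omega) (by omega)
    simp only [add_zero, Nat.Ioc_succ_singleton, Finset.sum_singleton, T_self]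
    rw [mul_inv_cancel_left₀ hpos.ne', h1]
    linarith
  | succ k ih =>
    have ih := ih (by omega)
    have h1 := F_sub_le_of_rates hC hregen hℓ hrec hsec (k := k) (by omega) hu
    set m := ℓ + 1 + k with hm
    have h3 := hrec.F_succ hregen (a := ℓ₁ + 1) (b := ℓ₂ + k + 1) (m := m) (by omega) (by omega)
      (by omega)
    have h4 := T_mul_le_F_sub hC hregen ℓ m (a := ℓ₁) (b := ℓ₂) (n := 1 + k) (a' := ℓ₁ + 1)
      (b' := ℓ₂ + k) (by omega) (by omega) (by omega)
    have hposm := T_pos (d := d) (k := m) (ℓ := ℓ) (by omega) (by omega)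
    have hposm' := T_pos (d := d) (k := m + 1) (ℓ := ℓ) (by omega) (by omega)
    have hT := T_succ d (show ℓ ≤ m by omega)
    have hT' := T_succ d (show ℓ + 1 ≤ m by omega)
    have hmcast : (m : ℝ) = ℓ₁ + 1 + (ℓ₂ + k) := by rw [hm, hℓ]; push_cast; ring
    have hmd : (0 : ℝ) ≤ d - m := by
      rw [sub_nonneg]
      exact_mod_cast (show m ≤ d by omega)
    rw [show ℓ₁ + ℓ₂ + (1 + k) = m by omega, ← hℓ,
      show ℓ₂ + (1 + k) = ℓ₂ + 1 + k by omega] at h4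
    push_cast at h4
    rw [show (d : ℝ) - (ℓ₁ + 1) - (ℓ₂ + k) = d - m by rw [hmcast]; ring] at h4
    rw [← add_assoc, ← add_assoc, ← hm,
      ← Finset.insert_Ioc_right_eq_Ioc_add_one (show ℓ ≤ m by omega), Finset.sum_insert (by simp),
      Finset.sum_insert (by simp)]
    set x := ∑ j ∈ Finset.Ioc ℓ m, (T d j ℓ)⁻¹ * C.hs {Atom.M j}
    have h5 := mul_inv_cancel_left₀ hposm'.ne' (C.hs {Atom.M (m + 1)})
    have h6 : C.F ℓ (ℓ₁ + 1) (ℓ₂ + k + 1) m - C.F ℓ (ℓ₁ + 1) (ℓ₂ + k) m ≤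
        ((d : ℝ) - m) * (u - x) := by
      refine le_of_mul_le_mul_left ?_ hposm
      have := mul_le_mul_of_nonneg_left h1 hmd
      linarith
    have h7 := mul_le_mul_of_nonneg_left (sub_le_sub_right huβ x) hmd
    rw [h3, mul_add, h5, hT, hT']
    linarith

theorem sentEntropy_add_T_mul_le (hC : C.Symmetrical) (hregen : C.NodeRegen) {ℓ₁ ℓ₂ ℓ : ℕ}
    (hℓ : ℓ = ℓ₁ + ℓ₂) (h12 : ℓ₁ ≤ ℓ₂) (hd : ℓ < d) {u : ℝ}
    (hu : ((d : ℝ) - ℓ) * u = C.F ℓ ℓ₁ (ℓ₂ + 1) ℓ - C.F ℓ ℓ₁ ℓ₂ ℓ) :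
    C.sentEntropy ℓ₁ + T d ℓ ℓ₁ * u ≤ C.F ℓ ℓ₁ ℓ₂ ℓ := by
  have hdℓ : (0 : ℝ) < d - ℓ := by
    rw [sub_pos]
    exact_mod_cast hd
  rcases ℓ₂ with _ | n
  · obtain rfl : ℓ₁ = 0 := by omega
    obtain rfl : ℓ = 0 := by omega
    rw [T_self, zero_mul, add_zero]
    exact hs_mono (ker_le_of_subset (by simp))
  · have h1 := hregen.sentEntropy_add_le hC ℓ (a := ℓ₁) (by omega)
    have h2 := F_exchange hC hregen ℓ ℓ (a := 0) (b := ℓ₁) (a' := ℓ₁) (b' := n + 1)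
      (Nat.zero_le _) h12 (by omega)
    have h3 := T_mul_le_F_sub hC hregen ℓ ℓ (a := ℓ₁) (b := 1) (n := n) (a' := ℓ₁)
      (b' := n + 1) le_rfl (by omega) (by omega)
    have hℓcast : (d : ℝ) - ℓ₁ - (n + 1 : ℕ) = d - ℓ := by rw [hℓ]; push_cast; ring
    rw [show ℓ₁ + 1 + n = ℓ by omega, show 1 + n = n + 1 by omega] at h3
    rw [hℓcast, ← hu, mul_left_comm] at h2 h3
    have h4 := le_of_mul_le_mul_left h2 hdℓ
    have h5 := le_of_mul_le_mul_left h3 hdℓ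
    rw [T_add d (k := ℓ₁ + 1) (by omega) (by omega), T_succ d le_rfl, T_self]
    push_cast at h4
    linarith

end Code

theorem statement1 {Ω V : Type} [Fintype Ω] {d : ℕ} (hd : 1 ≤ d)
    {ℓ₁ ℓ₂ ℓ : ℕ} (hℓdef : ℓ = ℓ₁ + ℓ₂) (hℓd : ℓ < d) (hℓ12 : ℓ₁ ≤ ℓ₂)
    (C : Code Ω V d) (hsym : C.Symmetrical) (hregen : C.NodeRegen)
    (hrec : C.MsgRecovery ℓ) (hsec : C.RepairSecrecy ℓ₁ ℓ₂)
    (α β : ℝ)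
    (hα : ∀ i ∈ Finset.Icc 1 (d + 1), C.HL [Atom.W i] ≤ α)
    (hβ : ∀ i ∈ Finset.Icc 1 (d + 1), ∀ j ∈ Finset.Icc 1 (d + 1), i ≠ j →
      C.HL [Atom.S i j] ≤ β) :
    α + T d d (ℓ₁ + 1) * β ≥
      (T d d ℓ₁ + (ℓ₁ : ℝ)) * ∑ j ∈ Finset.Icc (ℓ + 1) d, (T d j ℓ)⁻¹ * C.HL [Atom.M j] := by
  subst hℓdef
  set ℓ := ℓ₁ + ℓ₂ with hℓ
  have hdℓ : (0 : ℝ) < d - ℓ := by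
    rw [sub_pos]
    exact_mod_cast hℓd
  have hℓcast : (ℓ : ℝ) = ℓ₁ + ℓ₂ := by rw [hℓ]; push_cast; ring
  set u := (C.F ℓ ℓ₁ (ℓ₂ + 1) ℓ - C.F ℓ ℓ₁ ℓ₂ ℓ) / ((d : ℝ) - ℓ) with hu_def
  have hu : ((d : ℝ) - ℓ) * u = C.F ℓ ℓ₁ (ℓ₂ + 1) ℓ - C.F ℓ ℓ₁ ℓ₂ ℓ :=
    mul_div_cancel₀ _ hdℓ.ne'
  have huβ : u ≤ β := by
    refine le_of_mul_le_mul_left ?_ hdℓ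
    have := Code.F_succ_sub_le hregen ℓ ℓ (a := ℓ₁) (b := ℓ₂) hℓd.le hβ
    rw [hu, hℓcast]
    linarith
  obtain ⟨k, hk⟩ : ∃ k, d = ℓ + 1 + k := Nat.exists_eq_add_of_le hℓd
  have hY := Code.F_sub_le_of_rates hsym hregen hℓ hrec hsec hk.ge hu
  have hV := Code.F_succ_le_of_rates hsym hregen hℓ hrec hsec hk.ge hu huβ
  have hYnonneg := hregen.F_le ℓ d (a := ℓ₁) (b := ℓ₂) (a' := ℓ₁) (b' := ℓ₂ + 1 + k)
    (by omega) (by omega)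
  have hVge := hregen.F_le ℓ d (a := ℓ₁) (b := ℓ₂) (a' := ℓ₁ + 1) (b' := ℓ₂ + k)
    (by omega) (by omega)
  have hF := hsec.F_eq hℓ hℓd.le le_rfl
  rw [← hk] at hY hV
  have hx : ∑ j ∈ Finset.Icc (ℓ + 1) d, (T d j ℓ)⁻¹ * C.HL [Atom.M j] =
      ∑ j ∈ Finset.Ioc ℓ d, (T d j ℓ)⁻¹ * C.hs {Atom.M j} :=
    Finset.sum_congr (Finset.Icc_add_one_left_eq_Ioc ℓ d) fun j _ => by rw [Code.HL_singleton]
  rw [hx]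
  set x := ∑ j ∈ Finset.Ioc ℓ d, (T d j ℓ)⁻¹ * C.hs {Atom.M j}
  have hxu : x ≤ u := by
    have hpos := Code.T_pos hℓd le_rfl
    have : T d d ℓ * 0 ≤ T d d ℓ * (u - x) := by linarith
    linarith [le_of_mul_le_mul_left this hpos]
  have hsent := Code.card_mul_le_hs_sent hsym hregen ℓ ℓ hℓd (p := ℓ₁ + 1)
    (K := Finset.Icc 1 ℓ₁) (Finset.mem_Icc.2 (by omega)) (Finset.Icc_subset_Icc_right (by omega))
    (by rw [Finset.mem_Icc]; omega) (by simpa using hℓ12)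
  rw [sub_sub, ← hℓcast, ← hu, mul_left_comm, Nat.card_Icc, Nat.add_sub_cancel] at hsent
  have hsent := le_of_mul_le_mul_left hsent hdℓ
  have hW := Code.F_succ_zero_le (C := C) ℓ (a := ℓ₁) (by omega)
  have hα' := hα (ℓ₁ + 1) (Finset.mem_Icc.2 (by omega))
  rw [Code.HL_singleton] at hα'
  have hup := Code.F_add_sub_le hregen ℓ ℓ (a := ℓ₁ + 1) (b := 0) (n := ℓ₂) (by omega) hβ
  rw [zero_add, add_zero, show ℓ₁ + 1 + ℓ₂ = ℓ + 1 by omega] at hup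
  have hlow := Code.sentEntropy_add_T_mul_le hsym hregen hℓ hℓ12 hℓd hu
  have hT1 := Code.T_add d (show ℓ₁ ≤ ℓ by omega) hℓd.le
  have hT2 := Code.T_add d (show ℓ₁ + 1 ≤ ℓ + 1 by omega) hℓd
  have hTnonneg : 0 ≤ T d ℓ ℓ₁ := by
    rcases (show ℓ₁ ≤ ℓ by omega).eq_or_lt with h | h
    · rw [← h, Code.T_self]
    · exact (Code.T_pos h hℓd.le).le
  have hTx := mul_le_mul_of_nonneg_left hxu hTnonneg
  have hℓ₁x := mul_le_mul_of_nonneg_left hxu (Nat.cast_nonneg (α := ℝ) ℓ₁)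
  rw [hT1, hT2]
  linarith

end

end MDCSR
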